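/- Agmon-type interpolation bound via fractional integrals (the core inequality in the proof of the paper's Lemma 3.10): for every s with 0 ≤ s < 1/2 there exists a constant C_s > 0 such that for all g ∈ L²(0,1), setting v(t) := ∫_0^t g(r) dr for t ∈ [0,1], one has sup_{0 ≤ t ≤ 1} |v(t)|² ≤ C_s ‖D_{0+}^{-s} g‖_{L²(0,1)} ‖D_{0+}^{-(1−s)} g‖_{L²(0,1)}. -/

import Mathlib

open MeasureTheory Set

/-- Left Riemann–Liouville fractional integral of order `γ` (with base point `0`);
`D_{0+}^{0}` is the identity. -/
noncomputable def rlIntL (a γ : ℝ) (v : ℝ → ℝ) (t : ℝ) : ℝ :=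
  if γ = 0 then v t
  else (Real.Gamma γ)⁻¹ * ∫ s in a..t, (t - s) ^ (γ - 1) * v s

open scoped ENNReal

lemma aux_beta_int (a b : ℝ) (ha : 0 < a) (hb : 0 < b) :
    IntervalIntegrable (fun x : ℝ => (1 - x) ^ (a - 1) * x ^ (b - 1)) volume 0 1 := by
  have h := (Complex.betaIntegral_convergent (u := b) (v := a) (by simpa) (by simpa)).norm
  rw [intervalIntegrable_iff_integrableOn_Ioo_of_le zero_le_one] at h ⊢
  refine h.congr_fun (fun x hx => ?_) measurableSet_Ioo
  have h1 : ‖(x : ℂ) ^ ((b : ℂ) - 1)‖ = x ^ (b - 1) := by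
    rw [Complex.norm_cpow_eq_rpow_re_of_pos hx.1]; simp
  have h2 : ‖(1 - (x : ℂ)) ^ ((a : ℂ) - 1)‖ = (1 - x) ^ (a - 1) := by
    have : (1 - (x : ℂ)) = ((1 - x : ℝ) : ℂ) := by push_cast; ring
    rw [this, Complex.norm_cpow_eq_rpow_re_of_pos (by linarith [hx.2])]; simp
  simp only [norm_mul, h1, h2]
  ring

lemma aux_beta_pos (a b : ℝ) (ha : 0 < a) (hb : 0 < b) :
    0 < ∫ x in (0:ℝ)..1, (1 - x) ^ (a - 1) * x ^ (b - 1) := by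
  apply intervalIntegral.intervalIntegral_pos_of_pos_on (aux_beta_int a b ha hb) _ one_pos
  intro x hx
  exact mul_pos (Real.rpow_pos_of_pos (by linarith [hx.2]) _) (Real.rpow_pos_of_pos hx.1 _)

lemma aux_beta_scaled (a b q t : ℝ) (hqt : q < t) :
    ∫ r in q..t, (t - r) ^ (a - 1) * (r - q) ^ (b - 1) =
      (∫ x in (0:ℝ)..1, (1 - x) ^ (a - 1) * x ^ (b - 1)) * (t - q) ^ (a + b - 1) := by
  have hc : 0 < t - q := by linarith
  have h := intervalIntegral.integral_comp_mul_add (a := 0) (b := 1)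
    (fun r : ℝ => (t - r) ^ (a - 1) * (r - q) ^ (b - 1)) hc.ne' q
  have h2 : ∫ x in (0:ℝ)..1, (t - ((t - q) * x + q)) ^ (a - 1) * ((t - q) * x + q - q) ^ (b - 1)
      = ∫ x in (0:ℝ)..1, (t - q) ^ (a + b - 2) * ((1 - x) ^ (a - 1) * x ^ (b - 1)) := by
    apply intervalIntegral.integral_congr
    intro x hx
    rw [uIcc_of_le zero_le_one] at hx
    have e1 : t - ((t - q) * x + q) = (t - q) * (1 - x) := by ring
    have e2 : (t - q) * x + q - q = (t - q) * x := by ring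
    have e3 : a + b - 2 = (a - 1) + (b - 1) := by ring
    simp only [e1, e2, e3]
    rw [Real.mul_rpow hc.le (by linarith [hx.2]), Real.mul_rpow hc.le hx.1, Real.rpow_add hc]
    ring
  rw [h2, intervalIntegral.integral_const_mul] at h
  simp only [mul_zero, zero_add, mul_one, sub_add_cancel, smul_eq_mul] at h
  have e4 : a + b - 1 = (a + b - 2) + 1 := by ring
  rw [e4, Real.rpow_add hc, Real.rpow_one]
  field_simp at h
  linarith

lemma aux_semig (a b : ℝ) (ha : 0 < a) (hb : 0 < b) (hab : 1 ≤ a + b) (g : ℝ → ℝ)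
    (hg : IntegrableOn g (Ioo 0 1)) (t : ℝ) (ht : t ∈ Icc (0:ℝ) 1) :
    ∫ r in (0:ℝ)..t, (t - r) ^ (a - 1) * (∫ q in (0:ℝ)..r, (r - q) ^ (b - 1) * g q) =
      (∫ x in (0:ℝ)..1, (1 - x) ^ (a - 1) * x ^ (b - 1)) *
        ∫ q in (0:ℝ)..t, (t - q) ^ (a + b - 1) * g q := by
  set J := ∫ x in (0:ℝ)..1, (1 - x) ^ (a - 1) * x ^ (b - 1) with hJ
  have hJpos : 0 < J := aux_beta_pos a b ha hb
  set μ : Measure ℝ := volume.restrict (Ioo 0 t) with hμ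
  have hgt : Integrable g μ := hg.mono_set (Ioo_subset_Ioo le_rfl ht.2)
  -- the kernel
  set k : ℝ → ℝ → ℝ := fun r q => (Ioi q).indicator (fun r => (t - r) ^ (a - 1) * (r - q) ^ (b - 1)) r
    with hk
  have hkm : Measurable (fun p : ℝ × ℝ => k p.1 p.2) := by
    have : (fun p : ℝ × ℝ => k p.1 p.2) = {p : ℝ × ℝ | p.2 < p.1}.indicator
        (fun p => (t - p.1) ^ (a - 1) * (p.1 - p.2) ^ (b - 1)) := by
      ext p; simp [hk, indicator]
    rw [this]
    exact Measurable.indicator (by fun_prop) (measurableSet_lt measurable_snd measurable_fst)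
  have hk0 : ∀ r ∈ Ioo 0 t, ∀ q, 0 ≤ k r q := by
    intro r hr q
    simp only [hk, indicator, mem_Ioi]
    split_ifs with h
    · exact mul_nonneg (Real.rpow_nonneg (by linarith [hr.2]) _)
        (Real.rpow_nonneg (by linarith) _)
    · exact le_rfl
  have hset : ∀ q ∈ Ioo 0 t, Ioi q ∩ Ioo 0 t = Ioo q t := by
    intro q hq; ext x; simp only [mem_inter_iff, mem_Ioo, mem_Ioi]
    exact ⟨fun h => ⟨h.1, h.2.2⟩, fun h => ⟨h.1, by linarith [hq.1, h.1], h.2⟩⟩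
  have hki : ∀ q ∈ Ioo 0 t, Integrable (fun r => k r q) μ := by
    intro q hq
    simp only [hk]
    rw [integrable_indicator_iff measurableSet_Ioi, IntegrableOn, hμ,
      Measure.restrict_restrict measurableSet_Ioi, hset q hq]
    rw [← IntegrableOn, ← intervalIntegrable_iff_integrableOn_Ioo_of_le hq.2.le]
    apply intervalIntegral.intervalIntegrable_of_integral_ne_zero
    rw [aux_beta_scaled a b q t hq.2]
    exact (mul_pos hJpos (Real.rpow_pos_of_pos (by linarith [hq.2]) _)).ne'
  have hkv : ∀ q ∈ Ioo 0 t, ∫ r, k r q ∂μ = J * (t - q) ^ (a + b - 1) := by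
    intro q hq
    simp only [hk]
    rw [integral_indicator measurableSet_Ioi, hμ,
      Measure.restrict_restrict measurableSet_Ioi, hset q hq, ← integral_Ioc_eq_integral_Ioo,
      ← intervalIntegral.integral_of_le hq.2.le]
    exact aux_beta_scaled a b q t hq.2
  have hmem : ∀ᵐ q ∂μ, q ∈ Ioo 0 t := ae_restrict_mem measurableSet_Ioo
  have hHm : AEStronglyMeasurable (Function.uncurry fun r q => k r q * g q) (μ.prod μ) :=
    hkm.aestronglyMeasurable.mul hgt.1.comp_snd
  have hH : Integrable (Function.uncurry fun r q => k r q * g q) (μ.prod μ) := by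
    rw [integrable_prod_iff' hHm]
    constructor
    · filter_upwards [hmem] with q hq
      simpa [Function.uncurry] using (hki q hq).mul_const (g q)
    · have h1 : Integrable (fun q => J * (t - q) ^ (a + b - 1) * ‖g q‖) μ := by
        refine hgt.norm.bdd_mul (c := J) ?_ ?_
        · exact Measurable.aestronglyMeasurable (by fun_prop)
        · filter_upwards [hmem] with q hq
          have h0 : 0 < t - q := by linarith [hq.2]
          rw [Real.norm_of_nonneg (by positivity)]
          have : (t - q) ^ (a + b - 1) ≤ 1 :=
            Real.rpow_le_one h0.le (by linarith [hq.1, ht.2]) (by linarith)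
          nlinarith
      refine h1.congr ?_
      filter_upwards [hmem] with q hq
      rw [← hkv q hq, ← integral_mul_const]
      refine integral_congr_ae ?_
      filter_upwards [hmem] with r hr
      simp only [Function.uncurry, norm_mul]
      rw [Real.norm_of_nonneg (hk0 r hr q)]
  have hswap := integral_integral_swap hH
  have hR : ∫ q, ∫ r, k r q * g q ∂μ ∂μ = J * ∫ q in (0:ℝ)..t, (t - q) ^ (a + b - 1) * g q := by
    rw [intervalIntegral.integral_of_le ht.1, integral_Ioc_eq_integral_Ioo, ← integral_const_mul]
    refine integral_congr_ae ?_
    filter_upwards [hmem] with q hq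
    rw [integral_mul_const, hkv q hq]; ring
  rw [← hR, ← hswap, intervalIntegral.integral_of_le ht.1, integral_Ioc_eq_integral_Ioo]
  refine integral_congr_ae ?_
  filter_upwards [hmem] with r hr
  rw [intervalIntegral.integral_of_le hr.1.le, integral_Ioc_eq_integral_Ioo, ← integral_const_mul]
  have : (fun q => k r q * g q) = (Iio r).indicator
      (fun q => (t - r) ^ (a - 1) * ((r - q) ^ (b - 1) * g q)) := by
    ext q; simp only [hk, indicator, mem_Ioi, mem_Iio]; split_ifs <;> ring
  rw [this, integral_indicator measurableSet_Iio, hμ, Measure.restrict_restrict measurableSet_Iio]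
  congr 2
  ext x; simp only [mem_inter_iff, mem_Ioo, mem_Iio]
  exact ⟨fun h => ⟨h.2, h.1, by linarith [h.2, hr.2]⟩, fun h => ⟨h.2.1, h.1⟩⟩

lemma aux_memLp (b : ℝ) (hb : 0 < b) (g : ℝ → ℝ)
    (hg : MemLp g 2 (volume.restrict (Ioo (0:ℝ) 1))) :
    MemLp (fun r => ∫ q in (0:ℝ)..r, (r - q) ^ (b - 1) * g q) 2
      (volume.restrict (Ioo (0:ℝ) 1)) := by
  set μ : Measure ℝ := volume.restrict (Ioo 0 1) with hμ
  set K : ℝ → ℝ := (Ioo (0:ℝ) 1).indicator (fun x => x ^ (b - 1)) with hK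
  have hKm : Measurable K := Measurable.indicator (by fun_prop) measurableSet_Ioo
  have hmem : ∀ᵐ q ∂μ, q ∈ Ioo (0:ℝ) 1 := ae_restrict_mem measurableSet_Ioo
  have hKi : Integrable K volume := by
    rw [hK, integrable_indicator_iff measurableSet_Ioo,
      ← intervalIntegrable_iff_integrableOn_Ioo_of_le zero_le_one]
    exact intervalIntegral.intervalIntegrable_rpow' (by linarith)
  have hHm : AEStronglyMeasurable (fun p : ℝ × ℝ => K (p.1 - p.2) * g p.2) (μ.prod μ) :=
    (hKm.comp (measurable_fst.sub measurable_snd)).aestronglyMeasurable.mul hg.1.comp_snd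
  have heq : (fun r => ∫ q, K (r - q) * g q ∂μ) =ᵐ[μ]
      (fun r => ∫ q in (0:ℝ)..r, (r - q) ^ (b - 1) * g q) := by
    filter_upwards [hmem] with r hr
    rw [intervalIntegral.integral_of_le hr.1.le, integral_Ioc_eq_integral_Ioo]
    have h1 : ∫ q, K (r - q) * g q ∂μ
        = ∫ q, (Iio r).indicator (fun q => (r - q) ^ (b - 1) * g q) q ∂μ := by
      refine integral_congr_ae ?_
      filter_upwards [hmem] with q hq
      by_cases h : q < r
      · have : r - q ∈ Ioo (0:ℝ) 1 := ⟨by linarith, by linarith [hr.2, hq.1]⟩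
        simp [hK, indicator_of_mem this, h]
      · have : r - q ∉ Ioo (0:ℝ) 1 := fun h' => h (by linarith [h'.1])
        simp [hK, indicator_of_notMem this, h]
    rw [h1, integral_indicator measurableSet_Iio, hμ, Measure.restrict_restrict measurableSet_Iio]
    congr 2
    ext x; simp only [mem_inter_iff, mem_Ioo, mem_Iio]
    exact ⟨fun h => ⟨h.2.1, h.1⟩, fun h => ⟨h.2, h.1, by linarith [h.2, hr.2]⟩⟩
  refine MemLp.ae_eq heq ?_
  refine ⟨hHm.integral_prod_right', ?_⟩
  rw [eLpNorm_lt_top_iff_lintegral_rpow_enorm_lt_top (by norm_num) (by norm_num)]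
  simp only [ENNReal.toReal_ofNat]
  set k : ℝ → ℝ≥0∞ := fun x => ‖K x‖ₑ with hk
  have hkm : Measurable k := hKm.enorm
  set M : ℝ≥0∞ := ∫⁻ x, k x with hM
  have hMfin : M < ∞ := hKi.2
  have hgm : AEMeasurable (fun q => ‖g q‖ₑ) μ := hg.1.enorm
  have hgfin : ∫⁻ q, ‖g q‖ₑ ^ (2:ℝ) ∂μ < ∞ := by
    have := hg.2
    rw [eLpNorm_lt_top_iff_lintegral_rpow_enorm_lt_top (by norm_num) (by norm_num)] at this
    simpa using this
  have hb1 : ∀ r, ‖∫ q, K (r - q) * g q ∂μ‖ₑ ^ (2:ℝ) ≤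
      M * ∫⁻ q, k (r - q) * ‖g q‖ₑ ^ (2:ℝ) ∂μ := by
    intro r
    have hkr : AEMeasurable (fun q => k (r - q) ^ (1/2:ℝ)) μ := by
      have : Measurable (fun q => k (r - q) ^ (1/2:ℝ)) := by fun_prop
      exact this.aemeasurable
    have h1 : ‖∫ q, K (r - q) * g q ∂μ‖ₑ ≤ ∫⁻ q, k (r - q) * ‖g q‖ₑ ∂μ := by
      refine (enorm_integral_le_lintegral_enorm _).trans_eq ?_
      simp [hk, enorm_mul]
    have h2 := ENNReal.lintegral_mul_le_Lp_mul_Lq μ Real.HolderConjugate.two_two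
      (f := fun q => k (r - q) ^ (1/2:ℝ)) (g := fun q => k (r - q) ^ (1/2:ℝ) * ‖g q‖ₑ)
      hkr (hkr.mul hgm)
    have hsq : ∀ x : ℝ≥0∞, x ^ (1/2:ℝ) * x ^ (1/2:ℝ) = x := by
      intro x; rw [← ENNReal.rpow_add_of_nonneg _ _ (by norm_num) (by norm_num)]; norm_num
    have hsq2 : ∀ x : ℝ≥0∞, (x ^ (1/2:ℝ)) ^ (2:ℝ) = x := by
      intro x; rw [← ENNReal.rpow_mul]; norm_num
    simp only [Pi.mul_apply, ← mul_assoc, hsq, hsq2,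
      ENNReal.mul_rpow_of_nonneg _ _ (zero_le_two : (0:ℝ) ≤ 2)] at h2
    calc ‖∫ q, K (r - q) * g q ∂μ‖ₑ ^ (2:ℝ) ≤ _ :=
          ENNReal.rpow_le_rpow (h1.trans h2) zero_le_two
      _ = (∫⁻ q, k (r - q) ∂μ) * ∫⁻ q, k (r - q) * ‖g q‖ₑ ^ (2:ℝ) ∂μ := by
          rw [ENNReal.mul_rpow_of_nonneg _ _ (zero_le_two : (0:ℝ) ≤ 2), hsq2, hsq2]
      _ ≤ _ := by
          gcongr
          calc _ ≤ ∫⁻ q, k (r - q) := lintegral_mono' Measure.restrict_le_self le_rfl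
            _ = M := lintegral_sub_left_eq_self k r
  calc _ ≤ ∫⁻ r, M * ∫⁻ q, k (r - q) * ‖g q‖ₑ ^ (2:ℝ) ∂μ ∂μ := lintegral_mono hb1
    _ = M * ∫⁻ r, ∫⁻ q, k (r - q) * ‖g q‖ₑ ^ (2:ℝ) ∂μ ∂μ := lintegral_const_mul' _ _ hMfin.ne
    _ = M * ∫⁻ q, ∫⁻ r, k (r - q) * ‖g q‖ₑ ^ (2:ℝ) ∂μ ∂μ := by
        rw [lintegral_lintegral_swap]
        exact (hkm.comp (measurable_fst.sub measurable_snd)).aemeasurable.mul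
          ((hgm.pow_const 2).comp_snd)
    _ ≤ M * ∫⁻ q, M * ‖g q‖ₑ ^ (2:ℝ) ∂μ := by
        gcongr with q
        rw [lintegral_mul_const _ (by fun_prop)]
        gcongr
        calc _ ≤ ∫⁻ r, k (r - q) := lintegral_mono' Measure.restrict_le_self le_rfl
            _ = M := lintegral_sub_right_eq_self k q
    _ = M * (M * ∫⁻ q, ‖g q‖ₑ ^ (2:ℝ) ∂μ) := by rw [lintegral_const_mul' _ _ hMfin.ne]
    _ < ∞ := ENNReal.mul_lt_top hMfin (ENNReal.mul_lt_top hMfin hgfin)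

lemma aux_cs (S : Set ℝ) (hS : S ⊆ Ioo (0:ℝ) 1) (κ F : ℝ → ℝ)
    (hκ : MemLp κ 2 (volume.restrict S)) (hF : MemLp F 2 (volume.restrict (Ioo (0:ℝ) 1))) :
    |∫ r in S, κ r * F r| ≤ Real.sqrt (∫ r in S, κ r ^ 2) *
      Real.sqrt (∫ r in Ioo (0:ℝ) 1, F r ^ 2) := by
  have hFS : MemLp F 2 (volume.restrict S) := hF.mono_measure (Measure.restrict_mono hS le_rfl)
  have h := integral_mul_norm_le_Lp_mul_Lq (μ := volume.restrict S) (f := κ) (g := F)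
    Real.HolderConjugate.two_two (by simpa using hκ) (by simpa using hFS)
  simp only [Real.rpow_ofNat, Real.norm_eq_abs, sq_abs, ← Real.sqrt_eq_rpow] at h
  calc |∫ r in S, κ r * F r| ≤ ∫ r in S, |κ r * F r| := abs_integral_le_integral_abs
    _ = ∫ r in S, |κ r| * |F r| := by simp only [abs_mul]
    _ ≤ _ := h
    _ ≤ _ := by
      refine mul_le_mul_of_nonneg_left (Real.sqrt_le_sqrt ?_) (Real.sqrt_nonneg _)
      exact setIntegral_mono_set hF.integrable_sq (ae_of_all _ fun x => sq_nonneg _)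
        (LE.le.eventuallyLE hS)

lemma aux_diff_le (p w : ℝ) (hp : |p| ≤ 1) (hw : 0 < w) :
    |(w + 1) ^ p - w ^ p| ≤ w ^ (p - 1) := by
  have h := Convex.norm_image_sub_le_of_norm_hasDerivWithin_le (f := fun x : ℝ => x ^ p)
    (f' := fun x => p * x ^ (p - 1)) (s := Icc w (w + 1)) (x := w) (y := w + 1)
    (C := w ^ (p - 1)) ?_ ?_ (convex_Icc _ _) (by simp) (by simp)
  · simpa using h
  · intro x hx
    exact (Real.hasDerivAt_rpow_const (Or.inl (by linarith [hx.1]))).hasDerivWithinAt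
  · intro x hx
    have hx0 : 0 < x := by linarith [hx.1]
    rw [norm_mul, Real.norm_eq_abs, Real.norm_of_nonneg (by positivity)]
    have h1 : x ^ (p - 1) ≤ w ^ (p - 1) :=
      Real.rpow_le_rpow_of_nonpos hw hx.1 (by linarith [le_abs_self p])
    have : 0 < x ^ (p - 1) := by positivity
    nlinarith [abs_nonneg p]

lemma aux_D_int (p : ℝ) (hp1 : -(1/2) < p) (hp2 : p < 1/2) :
    IntegrableOn (fun w : ℝ => ((w + 1) ^ p - w ^ p) ^ 2) (Ioi 0) := by
  have hm : Measurable (fun w : ℝ => ((w + 1) ^ p - w ^ p) ^ 2) := by fun_prop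
  rw [← Ioc_union_Ioi_eq_Ioi (zero_le_one (α := ℝ))]
  apply IntegrableOn.union
  · have h1 : IntegrableOn (fun w : ℝ => 8 + 2 * w ^ (2 * p)) (Ioc 0 1) := by
      rw [← intervalIntegrable_iff_integrableOn_Ioc_of_le zero_le_one]
      exact intervalIntegrable_const.add
        ((intervalIntegral.intervalIntegrable_rpow' (by linarith)).const_mul 2)
    refine h1.mono' hm.aestronglyMeasurable ?_
    filter_upwards [ae_restrict_mem measurableSet_Ioc] with w hw
    rw [Real.norm_of_nonneg (sq_nonneg _)]
    have e : w ^ (2 * p) = (w ^ p) ^ 2 := by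
      rw [mul_comm, Real.rpow_mul hw.1.le]; norm_cast
    have h2 : (w + 1) ^ p ≤ 2 := by
      calc (w + 1) ^ p ≤ (w + 1) ^ (1:ℝ) :=
            Real.rpow_le_rpow_of_exponent_le (by linarith [hw.1]) (by linarith)
        _ ≤ 2 := by rw [Real.rpow_one]; linarith [hw.2]
    have h3 : 0 < (w + 1) ^ p := Real.rpow_pos_of_pos (by linarith [hw.1]) _
    rw [e]
    nlinarith [sq_nonneg ((w + 1) ^ p + w ^ p)]
  · have h1 : IntegrableOn (fun w : ℝ => w ^ (2 * p - 2)) (Ioi 1) :=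
      integrableOn_Ioi_rpow_of_lt (by linarith) one_pos
    refine h1.mono' hm.aestronglyMeasurable ?_
    filter_upwards [ae_restrict_mem measurableSet_Ioi] with w hw
    have hw0 : 0 < w := by have : 1 < w := hw; linarith
    rw [Real.norm_of_nonneg (sq_nonneg _)]
    have e : w ^ (2 * p - 2) = (w ^ (p - 1)) ^ 2 := by
      rw [show 2 * p - 2 = (p - 1) * 2 by ring, Real.rpow_mul hw0.le]; norm_cast
    rw [e, ← sq_abs]
    have := aux_diff_le p w (abs_le.2 ⟨by linarith, by linarith⟩) hw0
    gcongr

lemma aux_D_scale (p y : ℝ) (hp1 : -(1/2) < p) (hp2 : p < 1/2) (hy : 0 < y) :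
    IntegrableOn (fun w : ℝ => ((w + y) ^ p - w ^ p) ^ 2) (Ioi 0) ∧
    ∫ w in Ioi (0:ℝ), ((w + y) ^ p - w ^ p) ^ 2 =
      y ^ (2 * p + 1) * ∫ w in Ioi (0:ℝ), ((w + 1) ^ p - w ^ p) ^ 2 := by
  have e : ∀ w ∈ Ioi (0:ℝ), ((y * w + y) ^ p - (y * w) ^ p) ^ 2 =
      y ^ (2 * p) * ((w + 1) ^ p - w ^ p) ^ 2 := by
    intro w hw
    have hw : 0 < w := hw
    rw [show y * w + y = y * (w + 1) by ring, Real.mul_rpow hy.le (by linarith),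
      Real.mul_rpow hy.le hw.le, mul_comm 2 p, Real.rpow_mul hy.le]
    norm_cast
    ring
  constructor
  · have h := integrableOn_Ioi_comp_mul_left_iff
      (fun w : ℝ => ((w + y) ^ p - w ^ p) ^ 2) 0 hy
    rw [mul_zero] at h
    rw [← h]
    exact IntegrableOn.congr_fun ((aux_D_int p hp1 hp2).const_mul (y ^ (2 * p)))
      (fun w hw => (e w hw).symm) measurableSet_Ioi
  · have h := integral_comp_mul_left_Ioi'
      (fun w : ℝ => ((w + y) ^ p - w ^ p) ^ 2) 0 hy
    rw [mul_zero] at h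
    rw [← h, setIntegral_congr_fun measurableSet_Ioi e, integral_const_mul, smul_eq_mul,
      Real.rpow_add hy, Real.rpow_one]
    ring

lemma aux_k1 (p t' t : ℝ) (hp1 : -(1/2) < p) (h : t' ≤ t) :
    MemLp (fun r : ℝ => (t - r) ^ p) 2 (volume.restrict (Ioo t' t)) ∧
    ∫ r in Ioo t' t, ((t - r) ^ p) ^ 2 = (t - t') ^ (2 * p + 1) / (2 * p + 1) := by
  have e : ∀ r ∈ Ioo t' t, (t - r) ^ (2 * p) = ((t - r) ^ p) ^ 2 := by
    intro r hr
    rw [mul_comm, Real.rpow_mul (by linarith [hr.2])]; norm_cast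
  constructor
  · rw [memLp_two_iff_integrable_sq (Measurable.aestronglyMeasurable (by fun_prop))]
    have h1 : IntervalIntegrable (fun r : ℝ => (t - r) ^ (2 * p)) volume t' t := by
      have := (intervalIntegral.intervalIntegrable_rpow' (a := 0) (b := t - t') (r := 2 * p)
        (by linarith)).comp_sub_left t
      simpa using this.symm
    rw [intervalIntegrable_iff_integrableOn_Ioo_of_le h] at h1
    exact h1.congr_fun e measurableSet_Ioo
  · rw [← setIntegral_congr_fun measurableSet_Ioo e, ← integral_Ioc_eq_integral_Ioo,
      ← intervalIntegral.integral_of_le h,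
      intervalIntegral.integral_comp_sub_left (fun x : ℝ => x ^ (2 * p)) t,
      integral_rpow (Or.inl (by linarith)), sub_self, Real.zero_rpow (by linarith), sub_zero]

lemma aux_k2 (p t' t : ℝ) (hp1 : -(1/2) < p) (hp2 : p < 1/2) (h0 : 0 ≤ t') (h : t' < t) :
    MemLp (fun r : ℝ => (t - r) ^ p - (t' - r) ^ p) 2 (volume.restrict (Ioo 0 t')) ∧
    ∫ r in Ioo 0 t', ((t - r) ^ p - (t' - r) ^ p) ^ 2 ≤
      (t - t') ^ (2 * p + 1) * ∫ w in Ioi (0:ℝ), ((w + 1) ^ p - w ^ p) ^ 2 := by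
  obtain ⟨hi, hv⟩ := aux_D_scale p (t - t') hp1 hp2 (by linarith)
  have e : (fun r : ℝ => ((t - r) ^ p - (t' - r) ^ p) ^ 2) =
      fun r => ((t' - r + (t - t')) ^ p - (t' - r) ^ p) ^ 2 := by
    ext r; rw [show t' - r + (t - t') = t - r by ring]
  constructor
  · rw [memLp_two_iff_integrable_sq (Measurable.aestronglyMeasurable (by fun_prop)), e]
    have h1 : IntervalIntegrable (fun w : ℝ => ((w + (t - t')) ^ p - w ^ p) ^ 2) volume 0 t' := by
      rw [intervalIntegrable_iff_integrableOn_Ioc_of_le h0]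
      exact hi.mono_set Ioc_subset_Ioi_self
    have h2 := (h1.comp_sub_left t').symm
    simp only [sub_self, sub_zero] at h2
    rwa [intervalIntegrable_iff_integrableOn_Ioo_of_le h0] at h2
  · rw [← hv, e, ← integral_Ioc_eq_integral_Ioo, ← intervalIntegral.integral_of_le h0,
      intervalIntegral.integral_comp_sub_left (fun w : ℝ => ((w + (t - t')) ^ p - w ^ p) ^ 2) t',
      sub_self, sub_zero, intervalIntegral.integral_of_le h0]
    exact setIntegral_mono_set hi (ae_of_all _ fun x => sq_nonneg _)
        (LE.le.eventuallyLE Ioc_subset_Ioi_self)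

lemma aux_holder (p : ℝ) (hp1 : -(1/2) < p) (hp2 : p < 1/2) :
    ∃ C : ℝ, 0 ≤ C ∧ ∀ F : ℝ → ℝ, MemLp F 2 (volume.restrict (Ioo (0:ℝ) 1)) →
      ∀ t' t : ℝ, 0 ≤ t' → t' < t → t ≤ 1 →
      |(∫ r in (0:ℝ)..t, (t - r) ^ p * F r) - ∫ r in (0:ℝ)..t', (t' - r) ^ p * F r| ≤
        C * (t - t') ^ (p + 1/2) * Real.sqrt (∫ r in Ioo (0:ℝ) 1, F r ^ 2) := by
  set D := ∫ w in Ioi (0:ℝ), ((w + 1) ^ p - w ^ p) ^ 2 with hD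
  refine ⟨Real.sqrt (1 / (2 * p + 1)) + Real.sqrt D, by positivity, ?_⟩
  intro F hF t' t h0 hlt h1
  have hy : 0 < t - t' := by linarith
  have hint : ∀ S ⊆ Ioo (0:ℝ) 1, ∀ κ : ℝ → ℝ, MemLp κ 2 (volume.restrict S) →
      IntegrableOn (fun r => κ r * F r) S := by
    intro S hS κ hκ
    exact MemLp.integrable_mul hκ (hF.mono_measure (Measure.restrict_mono hS le_rfl))
  have hk := (aux_k1 p 0 t hp1 (by linarith)).1
  have hk' := (aux_k1 p 0 t' hp1 h0).1
  have s1 : Ioo 0 t ⊆ Ioo (0:ℝ) 1 := Ioo_subset_Ioo le_rfl h1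
  have s2 : Ioo 0 t' ⊆ Ioo (0:ℝ) 1 := Ioo_subset_Ioo le_rfl (by linarith)
  have s3 : Ioo t' t ⊆ Ioo (0:ℝ) 1 := Ioo_subset_Ioo h0 h1
  have i1 := hint _ s1 _ hk
  have i2 := hint _ s2 _ hk'
  obtain ⟨m3, v3⟩ := aux_k1 p t' t hp1 hlt.le
  obtain ⟨m4, v4⟩ := aux_k2 p t' t hp1 hp2 h0 hlt
  have b3 := aux_cs _ s3 _ F m3 hF
  have b4 := aux_cs _ s2 _ F m4 hF
  have hsplit : (∫ r in (0:ℝ)..t, (t - r) ^ p * F r) - ∫ r in (0:ℝ)..t', (t' - r) ^ p * F r =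
      (∫ r in Ioo t' t, (t - r) ^ p * F r) +
      ∫ r in Ioo 0 t', ((t - r) ^ p - (t' - r) ^ p) * F r := by
    have j1 : IntervalIntegrable (fun r => (t - r) ^ p * F r) volume 0 t := by
      rwa [intervalIntegrable_iff_integrableOn_Ioo_of_le (by linarith)]
    have j2 : IntervalIntegrable (fun r => (t' - r) ^ p * F r) volume 0 t' := by
      rwa [intervalIntegrable_iff_integrableOn_Ioo_of_le (by linarith)]
    have j3 : IntervalIntegrable (fun r => (t - r) ^ p * F r) volume 0 t' :=
      j1.mono_set (by rw [uIcc_of_le h0, uIcc_of_le (by linarith)]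
                      exact Icc_subset_Icc le_rfl hlt.le)
    have j4 : IntervalIntegrable (fun r => (t - r) ^ p * F r) volume t' t :=
      j1.mono_set (by rw [uIcc_of_le hlt.le, uIcc_of_le (by linarith)]
                      exact Icc_subset_Icc h0 le_rfl)
    rw [← integral_Ioc_eq_integral_Ioo, ← integral_Ioc_eq_integral_Ioo,
      ← intervalIntegral.integral_of_le h0, ← intervalIntegral.integral_of_le hlt.le,
      ← intervalIntegral.integral_add_adjacent_intervals j3 j4]
    simp only [sub_mul]
    rw [intervalIntegral.integral_sub j3 j2]
    ring
  have hpow : Real.sqrt ((t - t') ^ (2 * p + 1)) = (t - t') ^ (p + 1/2) := by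
    rw [Real.sqrt_eq_rpow, ← Real.rpow_mul hy.le]; congr 1; ring
  rw [hsplit]
  set N := Real.sqrt (∫ r in Ioo (0:ℝ) 1, F r ^ 2)
  rw [v3, div_eq_mul_one_div, Real.sqrt_mul (by positivity), hpow] at b3
  have b5 := b4.trans (mul_le_mul_of_nonneg_right (Real.sqrt_le_sqrt v4) (Real.sqrt_nonneg _))
  rw [Real.sqrt_mul (by positivity), hpow] at b5
  calc _ ≤ _ := abs_add_le _ _
    _ ≤ _ := add_le_add b3 b5
    _ = _ := by ring

lemma aux_interp (v : ℝ → ℝ) (hv : ContinuousOn v (Icc 0 1)) (hv0 : v 0 = 0) (s A B : ℝ)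
    (hs : s < 1/2) (hA : 0 ≤ A) (hB : 0 ≤ B)
    (h1 : ∀ t' t : ℝ, 0 ≤ t' → t' < t → t ≤ 1 → |v t - v t'| ≤ A * (t - t') ^ (1/2 - s))
    (h2 : ∀ t' t : ℝ, 0 ≤ t' → t' < t → t ≤ 1 →
      |(∫ r in (0:ℝ)..t, v r) - ∫ r in (0:ℝ)..t', v r| ≤ B * (t - t') ^ (1/2 + s))
    (t : ℝ) (ht : t ∈ Icc (0:ℝ) 1) : v t ^ 2 ≤ 4 * A * B := by
  have hα : 0 < 1/2 - s := by linarith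
  have key : ∀ δ : ℝ, 0 < δ → |v t| ≤ A * δ ^ (1/2 - s) + B * δ ^ (-(1/2 - s)) := by
    intro δ hδ
    have hB' : 0 ≤ B * δ ^ (-(1/2 - s)) := by positivity
    rcases lt_or_ge t δ with hlt | hge
    · rcases ht.1.eq_or_lt with h0 | h0
      · rw [← h0, hv0, abs_zero]; positivity
      · have h3 := h1 0 t le_rfl h0 ht.2
        rw [hv0, sub_zero, sub_zero] at h3
        have : t ^ (1/2 - s) ≤ δ ^ (1/2 - s) := Real.rpow_le_rpow h0.le hlt.le hα.le
        nlinarith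
    · have hvi : ∀ a b, a ∈ Icc (0:ℝ) 1 → b ∈ Icc (0:ℝ) 1 → IntervalIntegrable v volume a b := by
        intro a b ha hb
        apply ContinuousOn.intervalIntegrable
        exact hv.mono (uIcc_subset_Icc ha hb)
      have m0 : (0:ℝ) ∈ Icc (0:ℝ) 1 := by simp
      have mt : t - δ ∈ Icc (0:ℝ) 1 := ⟨by linarith, by linarith [ht.2]⟩
      have h3 := h2 (t - δ) t mt.1 (by linarith) ht.2
      rw [intervalIntegral.integral_interval_sub_left (hvi _ _ m0 ht) (hvi _ _ m0 mt),
        sub_sub_cancel] at h3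
      have h4 : |∫ r in (t - δ)..t, (v t - v r)| ≤ A * δ ^ (1/2 - s) * δ := by
        have := intervalIntegral.norm_integral_le_of_norm_le_const (a := t - δ) (b := t)
          (C := A * δ ^ (1/2 - s)) (f := fun r => v t - v r) ?_
        · rw [sub_sub_cancel, abs_of_pos hδ] at this
          simpa using this
        · intro r hr
          rw [uIoc_of_le (by linarith)] at hr
          rw [Real.norm_eq_abs]
          rcases hr.2.eq_or_lt with h | h
          · rw [h, sub_self, abs_zero]; positivity
          · refine (h1 r t (by linarith [hr.1, mt.1]) h ht.2).trans ?_
            have : (t - r) ^ (1/2 - s) ≤ δ ^ (1/2 - s) :=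
              Real.rpow_le_rpow (by linarith) (by linarith [hr.1]) hα.le
            gcongr
      rw [intervalIntegral.integral_sub intervalIntegrable_const (hvi _ _ mt ht),
        intervalIntegral.integral_const, sub_sub_cancel, smul_eq_mul] at h4
      have h5 : |δ * v t| ≤ A * δ ^ (1/2 - s) * δ + B * δ ^ (1/2 + s) := by
        have := abs_add_le (δ * v t - ∫ r in (t - δ)..t, v r) (∫ r in (t - δ)..t, v r)
        rw [sub_add_cancel] at this
        linarith
      have h6 : δ ^ (1/2 + s) = δ ^ (-(1/2 - s)) * δ := by
        rw [← Real.rpow_add_one hδ.ne']; congr 1; ring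
      rw [h6, abs_mul, abs_of_pos hδ] at h5
      refine le_of_mul_le_mul_left ?_ hδ
      linarith
  have hd : discrim A (-|v t|) B ≤ 0 := by
    apply discrim_le_zero
    intro x
    rcases le_or_gt x 0 with hx | hx
    · have : 0 ≤ |v t| * (-x) := mul_nonneg (abs_nonneg _) (by linarith)
      nlinarith [mul_nonneg hA (mul_self_nonneg x)]
    · have h3 := key (x ^ (1/2 - s)⁻¹) (by positivity)
      rw [Real.rpow_neg (by positivity), Real.rpow_inv_rpow hx.le hα.ne'] at h3
      have h4 := mul_le_mul_of_nonneg_right h3 hx.le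
      rw [add_mul, mul_assoc B, inv_mul_cancel₀ hx.ne'] at h4
      linarith
  rw [discrim, neg_sq, sq_abs] at hd
  linarith

theorem stmt15 (s : ℝ) (hs0 : 0 ≤ s) (hs : s < 1 / 2) :
    ∃ C : ℝ, 0 < C ∧ ∀ g : ℝ → ℝ,
      MemLp g 2 (volume.restrict (Set.Ioo (0 : ℝ) 1)) →
      ∀ t ∈ Set.Icc (0 : ℝ) 1,
        (∫ r in (0 : ℝ)..t, g r) ^ 2 ≤
          C * Real.sqrt (∫ r in Set.Ioo (0 : ℝ) 1, (rlIntL 0 s g r) ^ 2) *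
              Real.sqrt (∫ r in Set.Ioo (0 : ℝ) 1, (rlIntL 0 (1 - s) g r) ^ 2) := by
  obtain ⟨C1, hC1, H1⟩ := aux_holder (-s) (by linarith) (by linarith)
  obtain ⟨C2, hC2, H2⟩ := aux_holder s (by linarith) hs
  -- representation of v through `f`
  obtain ⟨c1, hc1, R1⟩ : ∃ c1 : ℝ, 0 < c1 ∧ ∀ g : ℝ → ℝ, IntegrableOn g (Ioo 0 1) →
      ∀ t ∈ Icc (0:ℝ) 1, ∫ r in (0:ℝ)..t, (t - r) ^ (-s) * rlIntL 0 s g r =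
        c1 * ∫ r in (0:ℝ)..t, g r := by
    rcases hs0.eq_or_lt with h | h
    · refine ⟨1, one_pos, fun g hg t ht => ?_⟩
      simp [rlIntL, ← h]
    · refine ⟨(Real.Gamma s)⁻¹ * ∫ x in (0:ℝ)..1, (1 - x) ^ (1 - s - 1) * x ^ (s - 1),
        mul_pos (inv_pos.2 (Real.Gamma_pos_of_pos h)) (aux_beta_pos (1 - s) s (by linarith) h),
        fun g hg t ht => ?_⟩
      have := aux_semig (1 - s) s (by linarith) h (by linarith) g hg t ht
      have e0 : 1 - s + s - 1 = 0 := by ring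
      simp only [e0, Real.rpow_zero, one_mul] at this
      rw [mul_assoc, ← this, ← intervalIntegral.integral_const_mul]
      congr 1; ext r
      rw [rlIntL, if_neg h.ne', show 1 - s - 1 = -s by ring]; ring
  obtain ⟨c2, hc2, R2⟩ : ∃ c2 : ℝ, 0 < c2 ∧ ∀ g : ℝ → ℝ, IntegrableOn g (Ioo 0 1) →
      ∀ t ∈ Icc (0:ℝ) 1, ∫ r in (0:ℝ)..t, (t - r) ^ s * rlIntL 0 (1 - s) g r =
        c2 * ∫ r in (0:ℝ)..t, ∫ q in (0:ℝ)..r, g q := by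
    have hp1 := aux_beta_pos (1 + s) (1 - s) (by linarith) (by linarith)
    have hp2 := aux_beta_pos 1 1 one_pos one_pos
    refine ⟨(Real.Gamma (1 - s))⁻¹ * (∫ x in (0:ℝ)..1, (1 - x) ^ (1 + s - 1) * x ^ (1 - s - 1)) /
      ∫ x in (0:ℝ)..1, (1 - x) ^ ((1:ℝ) - 1) * x ^ ((1:ℝ) - 1),
      div_pos (mul_pos (inv_pos.2 (Real.Gamma_pos_of_pos (by linarith))) hp1) hp2,
      fun g hg t ht => ?_⟩
    have E1 := aux_semig (1 + s) (1 - s) (by linarith) (by linarith) (by linarith) g hg t ht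
    have E2 := aux_semig 1 1 one_pos one_pos (by norm_num) g hg t ht
    set J1 := ∫ x in (0:ℝ)..1, (1 - x) ^ (1 + s - 1) * x ^ (1 - s - 1)
    set J2 := ∫ x in (0:ℝ)..1, (1 - x) ^ ((1:ℝ) - 1) * x ^ ((1:ℝ) - 1)
    have e0 : (1:ℝ) + s + (1 - s) - 1 = 1 + 1 - 1 := by ring
    rw [e0] at E1
    have E3 : ∫ r in (0:ℝ)..t, ∫ q in (0:ℝ)..r, g q =
        J2 * ∫ q in (0:ℝ)..t, (t - q) ^ ((1:ℝ) + 1 - 1) * g q := by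
      rw [← E2]; simp
    rw [E3]
    have E4 : ∫ r in (0:ℝ)..t, (t - r) ^ s * rlIntL 0 (1 - s) g r = (Real.Gamma (1 - s))⁻¹ *
        (J1 * ∫ q in (0:ℝ)..t, (t - q) ^ ((1:ℝ) + 1 - 1) * g q) := by
      rw [← E1, ← intervalIntegral.integral_const_mul]
      congr 1; ext r
      rw [rlIntL, if_neg (by linarith), show 1 + s - 1 = s by ring]; ring
    rw [E4]
    field_simp
  refine ⟨4 * (C1 / c1) * (C2 / c2) + 1, by positivity, fun g hg t ht => ?_⟩
  have hgi : IntegrableOn g (Ioo 0 1) := hg.integrable (by norm_num)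
  have mf : ∀ γ : ℝ, 0 ≤ γ → MemLp (rlIntL 0 γ g) 2 (volume.restrict (Ioo (0:ℝ) 1)) := by
    intro γ hγ
    rcases hγ.eq_or_lt with h | h
    · have : rlIntL 0 γ g = g := by ext r; simp [rlIntL, ← h]
      rwa [this]
    · have : rlIntL 0 γ g = fun r => (Real.Gamma γ)⁻¹ *
          ∫ q in (0:ℝ)..r, (r - q) ^ (γ - 1) * g q := by
        ext r; simp [rlIntL, h.ne']
      rw [this]
      exact (aux_memLp γ h g hg).const_mul _
  have K1 := H1 _ (mf s hs0)
  have K2 := H2 _ (mf (1 - s) (by linarith))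
  set Nf := Real.sqrt (∫ r in Set.Ioo (0 : ℝ) 1, (rlIntL 0 s g r) ^ 2)
  set Nh := Real.sqrt (∫ r in Set.Ioo (0 : ℝ) 1, (rlIntL 0 (1 - s) g r) ^ 2)
  have hNf : 0 ≤ Nf := Real.sqrt_nonneg _
  have hNh : 0 ≤ Nh := Real.sqrt_nonneg _
  have hcont : ContinuousOn (fun t => ∫ r in (0:ℝ)..t, g r) (Icc 0 1) := by
    have := intervalIntegral.continuousOn_primitive_interval (a := 0) (b := 1) (f := g)
      (μ := volume) (by rw [uIcc_of_le zero_le_one, integrableOn_Icc_iff_integrableOn_Ioo]; exact hgi)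
    rwa [uIcc_of_le zero_le_one] at this
  have main := aux_interp (fun t => ∫ r in (0:ℝ)..t, g r) hcont (by simp) s
    (C1 / c1 * Nf) (C2 / c2 * Nh) hs (by positivity) (by positivity) ?_ ?_ t ht
  · have : 0 ≤ Nf * Nh := mul_nonneg hNf hNh
    calc _ ≤ _ := main
      _ ≤ _ := by nlinarith
  · intro t' t h0 hlt h1
    have h := K1 t' t h0 hlt h1
    rw [R1 g hgi t ⟨by linarith, h1⟩, R1 g hgi t' ⟨h0, by linarith⟩, ← mul_sub, abs_mul,
      abs_of_pos hc1, show -s + 1/2 = 1/2 - s by ring] at h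
    refine le_of_mul_le_mul_left (h.trans_eq ?_) hc1
    field_simp
  · intro t' t h0 hlt h1
    have h := K2 t' t h0 hlt h1
    rw [R2 g hgi t ⟨by linarith, h1⟩, R2 g hgi t' ⟨h0, by linarith⟩, ← mul_sub, abs_mul,
      abs_of_pos hc2, show s + 1/2 = 1/2 + s by ring] at h
    refine le_of_mul_le_mul_left (h.trans_eq ?_) hc2
    field_simp
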